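/- arXiv:2109.07186 — 2 statements merged into one kernel-verified Lean document; each statement's English description precedes it below -/
import Mathlib

section
/- Let F₂ be the free group of rank 2, let k ≥ 0, and let F₂ × F₂ = H₀ ≥ H₁ ≥ ⋯ ≥ H_k be a chain of subgroups such that, for every 0 ≤ i ≤ k−1, H_{i+1} is normal in H_i and the quotient H_i/H_{i+1} is either finite or free abelian of finite rank. Then there exist subgroups A and B of H_k, each normal in H_k and each isomorphic to a free group of countably infinite rank, such that A ∩ B is trivial and every element of A commutes with every element of B (so that A and B generate a subgroup of H_k isomorphic to the direct product of two free groups of countably infinite rank, normal in H_k). -/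
/-- The free group of rank 2. -/
abbrev F2 : Type := FreeGroup (Fin 2)

open SemidirectProduct
open scoped commutatorElement

/-- The action of the units of a field on its additive group, written multiplicatively. -/
def unitsMulAut (K : Type) [Field K] : Kˣ →* MulAut (Multiplicative K) :=
  (MulAutMultiplicative K).symm.toMonoidHom.comp (DistribMulAction.toAddAut Kˣ K)

theorem unitsMulAut_apply {K : Type} [Field K] (u : Kˣ) (x : K) :
    unitsMulAut K u (Multiplicative.ofAdd x) = Multiplicative.ofAdd ((u : K) * x) := rfl

/-- Any two elements of any group are the images of `x` and `y` under a homomorphism. -/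
def IsFreePair {G : Type} [Group G] (x y : G) : Prop :=
  ∀ (W : Type) [Group W] (a b : W), ∃ f : G →* W, f x = a ∧ f y = b

theorem FreeGroupBasis.exists_isFreePair {ι G : Type} [Group G] [Nontrivial ι]
    (b : FreeGroupBasis ι G) : ∃ x y : G, IsFreePair x y := by
  classical
  obtain ⟨i, j, hij⟩ := exists_pair_ne ι
  refine ⟨b i, b j, fun W _ u v => ⟨b.lift (fun l => if l = i then u else v), ?_, ?_⟩⟩
  · simp
  · simp [hij.symm]

theorem IsFreeGroup.exists_isFreePair {G : Type} [Group G] [IsFreeGroup G]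
    (hG : ¬ ∀ x y : G, x * y = y * x) : ∃ x y : G, IsFreePair x y := by
  obtain ⟨ι, ⟨b⟩⟩ := IsFreeGroup.nonempty_basis (G := G)
  cases subsingleton_or_nontrivial ι with
  | inr _ => exact b.exists_isFreePair
  | inl h =>
    refine absurd (fun x y => b.repr.injective ?_) hG
    rw [map_mul, map_mul]
    rcases isEmpty_or_nonempty ι with _ | ⟨⟨i⟩⟩
    · exact Subsingleton.elim _ _
    · have : Unique ι := uniqueOfSubsingleton i
      exact IsCyclic.isMulCommutative.is_comm.comm _ _

theorem IsFreePair.pow_mul_pow_ne {G : Type} [Group G] {x y : G} (h : IsFreePair x y) {n : ℕ}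
    (hn : n ≠ 0) : x ^ n * y ^ n ≠ y ^ n * x ^ n := by
  intro hc
  obtain ⟨f, hx, hy⟩ := h (Multiplicative ℚ ⋊[unitsMulAut ℚ] ℚˣ)
    (inr (Units.mk0 2 two_ne_zero)) (inl (Multiplicative.ofAdd 1))
  have h1 := congrArg f hc
  simp only [map_mul, map_pow, hx, hy] at h1
  simp only [← map_pow] at h1
  rw [← mul_inv_eq_iff_eq_mul, ← map_inv, ← inl_aut, inl_inj, ← ofAdd_nsmul,
    unitsMulAut_apply, Multiplicative.ofAdd.injective.eq_iff] at h1
  have h2 : (n : ℚ) ≠ 0 := by exact_mod_cast hn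
  have h3 : (2 : ℚ) ^ n = 1 := by simpa [h2] using h1
  exact (one_lt_pow₀ one_lt_two hn).ne' h3

theorem IsFreePair.not_fg_commutator {G : Type} [Group G] {x y : G} (h : IsFreePair x y) :
    ¬ Group.FG (commutator G) := by
  intro hfg
  let K := RatFunc (ZMod 2)
  let u : Kˣ := Units.mk0 RatFunc.X RatFunc.X_ne_zero
  obtain ⟨f, hx, hy⟩ := h (Multiplicative K ⋊[unitsMulAut K] Kˣ)
    (inr u) (inl (Multiplicative.ofAdd 1))
  let N := (commutator G).map f
  let S : Subgroup (Multiplicative K) := N.comap inl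
  have hN : N ≤ (inl : Multiplicative K →* Multiplicative K ⋊[unitsMulAut K] Kˣ).range := by
    rw [range_inl_eq_ker_rightHom, Subgroup.map_le_iff_le_comap, MonoidHom.comap_ker]
    exact Abelianization.commutator_subset_ker _
  have hSN : S.map inl = N := by
    rw [Subgroup.map_comap_eq, inf_eq_right.mpr hN]
  have hNfg : Group.FG N := Group.fg_of_surjective (f.subgroupMap_surjective (commutator G))
  have hSfg : Group.FG S := by
    have e := S.equivMapOfInjective (inl (φ := unitsMulAut K)) inl_injective
    rw [hSN] at e
    exact Group.fg_of_surjective (f := e.symm.toMonoidHom) e.symm.surjective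
  have hfin : Finite S := by
    refine CommGroup.finite_of_fg_isMulTorsion S fun s => ?_
    refine isOfFinOrder_iff_pow_eq_one.mpr ⟨2, two_pos, Subtype.ext ?_⟩
    have : CharP K 2 := charP_of_injective_algebraMap (algebraMap (ZMod 2) K).injective 2
    rw [pow_two]
    exact CharTwo.add_self_eq_zero (R := K) (s : Multiplicative K).toAdd
  have hmem (n : ℕ) : Multiplicative.ofAdd ((RatFunc.X : K) ^ n * (RatFunc.X - 1)) ∈ S := by
    refine ⟨x ^ n * ⁅x, y⁆ * (x ^ n)⁻¹, ?_, ?_⟩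
    · exact (inferInstance : (commutator G).Normal).conj_mem _
        (Subgroup.commutator_mem_commutator (Subgroup.mem_top _) (Subgroup.mem_top _)) _
    · rw [commutatorElement_def, map_mul, map_mul, map_mul, map_mul, map_mul, map_inv, map_inv,
        map_inv, map_pow, hx, hy, ← map_inv inr u, ← inl_aut, ← map_inv inl, ← map_mul inl,
        ← map_pow, ← map_inv inr (u ^ n), ← inl_aut, inl_inj,
        unitsMulAut_apply, ← ofAdd_neg, ← ofAdd_add, unitsMulAut_apply]
      simp [u, sub_eq_add_neg]
  refine not_injective_infinite_finite (fun n : ℕ => (⟨_, hmem n⟩ : S)) fun m n hmn => ?_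
  have h1 : (RatFunc.X : K) ^ m * (RatFunc.X - 1) = RatFunc.X ^ n * (RatFunc.X - 1) :=
    Multiplicative.ofAdd.injective (Subtype.ext_iff.mp hmn)
  have h2 : (RatFunc.X : K) - 1 ≠ 0 := by
    rw [← RatFunc.algebraMap_X, ← map_one (algebraMap (Polynomial (ZMod 2)) K), ← map_sub]
    exact RatFunc.algebraMap_ne_zero (Polynomial.X_sub_C_ne_zero 1)
  have h3 := mul_right_cancel₀ h2 h1
  rw [← RatFunc.algebraMap_X, ← map_pow, ← map_pow] at h3
  simpa using congrArg Polynomial.natDegree (RatFunc.algebraMap_injective _ h3)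

theorem IsFreeGroup.exists_infinite_basis {G : Type} [Group G] [IsFreeGroup G]
    (hG : ¬ Group.FG G) : ∃ ι : Type, Infinite ι ∧ Nonempty (FreeGroupBasis ι G) := by
  obtain ⟨ι, ⟨b⟩⟩ := IsFreeGroup.nonempty_basis (G := G)
  refine ⟨ι, ?_, ⟨b⟩⟩
  by_contra h
  rw [not_infinite_iff_finite] at h
  exact hG (Group.fg_of_surjective (f := b.repr.symm.toMonoidHom) b.repr.symm.surjective)

theorem IsFreeGroup.nonempty_mulEquiv_freeGroup_nat {G : Type} [Group G] [IsFreeGroup G]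
    [Countable G] (hG : ¬ Group.FG G) : Nonempty (G ≃* FreeGroup ℕ) := by
  obtain ⟨ι, _, ⟨b⟩⟩ := IsFreeGroup.exists_infinite_basis hG
  have : Countable ι := b.injective.countable
  obtain ⟨e⟩ := nonempty_equiv_of_countable (α := ι) (β := ℕ)
  exact ⟨(b.reindex e).repr⟩

theorem IsFreePair.mul_ne_mul {G : Type} [Group G] {x y : G} (h : IsFreePair x y) :
    x * y ≠ y * x := by
  simpa using h.pow_mul_pow_ne one_ne_zero

theorem IsFreePair.exists_noncommuting_in_commutator {G : Type} [Group G] [IsFreeGroup G]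
    {x y : G} (h : IsFreePair x y) :
    ∃ a ∈ commutator G, ∃ b ∈ commutator G, a * b ≠ b * a := by
  obtain ⟨ι, _, ⟨b⟩⟩ := IsFreeGroup.exists_infinite_basis h.not_fg_commutator
  obtain ⟨u, v, huv⟩ := b.exists_isFreePair
  refine ⟨u, u.2, v, v.2, fun hc => huv.mul_ne_mul (Subtype.ext hc)⟩

/-- Passing from a noncommutative free subgroup to a subgroup containing all its `n`-th powers or
its commutator subgroup preserves noncommutativity. -/
theorem Subgroup.exists_noncommuting_of_step {P : Type} [Group P] {M M' : Subgroup P}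
    [IsFreeGroup M] (hM : ∃ a ∈ M, ∃ b ∈ M, a * b ≠ b * a)
    (h : (∃ n ≠ 0, ∀ g ∈ M, g ^ n ∈ M') ∨ ⁅M, M⁆ ≤ M') :
    ∃ a ∈ M', ∃ b ∈ M', a * b ≠ b * a := by
  obtain ⟨a, ha, b, hb, hab⟩ := hM
  obtain ⟨x, y, hxy⟩ := IsFreeGroup.exists_isFreePair (G := M) fun hc =>
    hab (congrArg Subtype.val (hc ⟨a, ha⟩ ⟨b, hb⟩))
  rcases h with ⟨n, hn, hpow⟩ | hcomm
  · exact ⟨_, hpow x x.2, _, hpow y y.2, fun hc => hxy.pow_mul_pow_ne hn (Subtype.ext hc)⟩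
  · obtain ⟨u, hu, v, hv, huv⟩ := hxy.exists_noncommuting_in_commutator
    rw [← Subgroup.map_subtype_commutator] at hcomm
    exact ⟨u, hcomm ⟨u, hu, rfl⟩, v, hcomm ⟨v, hv, rfl⟩, fun hc => huv (Subtype.ext hc)⟩

theorem Subgroup.isFreeGroup_of_le {P : Type} [Group P] {M K : Subgroup P} [IsFreeGroup K]
    (h : M ≤ K) : IsFreeGroup M :=
  IsFreeGroup.ofMulEquiv (Subgroup.subgroupOfEquivOfLe h)

theorem Subgroup.normal_commutator_subgroupOf {P : Type} [Group P] {M H : Subgroup P}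
    (hMH : M ≤ H) (h : (M.subgroupOf H).Normal) : (⁅M, M⁆.subgroupOf H).Normal := by
  have hM : ⁅M, M⁆.subgroupOf H = ⁅M.subgroupOf H, M.subgroupOf H⁆ := by
    apply Subgroup.map_injective H.subtype_injective
    rw [Subgroup.map_commutator, Subgroup.map_subgroupOf_eq_of_le hMH,
      Subgroup.map_subgroupOf_eq_of_le ((Subgroup.commutator_le_self M).trans hMH)]
  rw [hM]
  infer_instance

/-- A free noncommutative normal subgroup `K` of a group meets the last term of a subnormal
series with finite or abelian quotients in a group whose commutator subgroup is free of infinite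
rank. -/
theorem Subgroup.exists_normal_freeGroup_nat_of_chain {P : Type} [Group P] [Countable P]
    (K : Subgroup P) [K.Normal] [IsFreeGroup K] (hK : ∃ a ∈ K, ∃ b ∈ K, a * b ≠ b * a)
    (k : ℕ) (H : ℕ → Subgroup P) (h0 : H 0 = ⊤)
    (hnormal : ∀ i < k, ((H (i + 1)).subgroupOf (H i)).Normal)
    (hquot : ∀ i < k,
      Finite ((H i) ⧸ (H (i + 1)).subgroupOf (H i)) ∨
      ∃ (n : ℕ) (φ : (H i) →* Multiplicative (Fin n → ℤ)),
        Function.Surjective φ ∧ φ.ker = (H (i + 1)).subgroupOf (H i)) :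
    ∃ A : Subgroup P, A ≤ H k ∧ A ≤ K ∧ (A.subgroupOf (H k)).Normal ∧
      Nonempty (A ≃* FreeGroup ℕ) := by
  have hfree (i : ℕ) : IsFreeGroup ↥(H i ⊓ K) := Subgroup.isFreeGroup_of_le inf_le_right
  have hne (i : ℕ) (hi : i ≤ k) : ∃ a ∈ H i ⊓ K, ∃ b ∈ H i ⊓ K, a * b ≠ b * a := by
    induction i with
    | zero => simpa [h0] using hK
    | succ i ih =>
      have := hnormal i hi
      refine Subgroup.exists_noncommuting_of_step (ih (by omega)) ?_
      rcases hquot i hi with hfin | ⟨n, φ, -, hφ⟩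
      · refine Or.inl ⟨((H (i + 1)).subgroupOf (H i)).index, ?_, fun g hg => ?_⟩
        · exact Subgroup.index_ne_zero_of_finite
        · exact ⟨Subgroup.pow_index_mem ((H (i + 1)).subgroupOf (H i)) ⟨g, hg.1⟩,
            K.pow_mem hg.2 _⟩
      · refine Or.inr (le_inf ?_ ((Subgroup.commutator_le_self _).trans inf_le_right))
        refine (Subgroup.commutator_mono inf_le_left inf_le_left).trans ?_
        rw [← Subgroup.map_subtype_commutator, Subgroup.map_le_iff_le_comap]
        exact (Abelianization.commutator_subset_ker φ).trans hφ.le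
  let M := H k ⊓ K
  have hMH : M ≤ H k := inf_le_left
  have hA : ⁅M, M⁆ ≤ M := Subgroup.commutator_le_self M
  refine ⟨⁅M, M⁆, hA.trans hMH, hA.trans inf_le_right,
    Subgroup.normal_commutator_subgroupOf hMH ?_, ?_⟩
  · rw [Subgroup.inf_subgroupOf_left]
    infer_instance
  · obtain ⟨a, ha, b, hb, hab⟩ := hne k le_rfl
    obtain ⟨x, y, hxy⟩ := IsFreeGroup.exists_isFreePair (G := M) fun hc =>
      hab (congrArg Subtype.val (hc ⟨a, ha⟩ ⟨b, hb⟩))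
    obtain ⟨e⟩ := IsFreeGroup.nonempty_mulEquiv_freeGroup_nat hxy.not_fg_commutator
    have e' := (_root_.commutator M).equivMapOfInjective M.subtype M.subtype_injective
    rw [Subgroup.map_subtype_commutator] at e'
    exact ⟨e'.symm.trans e⟩

/-- If `F₂ × F₂ = H₀ ≥ H₁ ≥ ⋯ ≥ H_k` is a chain of subgroups with each `H_{i+1}` normal
in `H_i` and each quotient `H_i/H_{i+1}` finite or free abelian of finite rank, then
`H_k` contains two elementwise-commuting normal subgroups `A` and `B`, intersecting
trivially, each isomorphic to a free group of countably infinite rank. -/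
theorem chain_in_F2xF2_contains_product_of_free_groups
    (k : ℕ) (H : ℕ → Subgroup (F2 × F2))
    (h0 : H 0 = ⊤)
    (hle : ∀ i < k, H (i + 1) ≤ H i)
    (hnormal : ∀ i < k, ((H (i + 1)).subgroupOf (H i)).Normal)
    (hquot : ∀ i < k,
      Finite ((H i) ⧸ (H (i + 1)).subgroupOf (H i)) ∨
      ∃ (n : ℕ) (φ : (H i) →* Multiplicative (Fin n → ℤ)),
        Function.Surjective φ ∧ φ.ker = (H (i + 1)).subgroupOf (H i)) :
    ∃ A B : Subgroup (F2 × F2),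
      A ≤ H k ∧ B ≤ H k ∧
      (A.subgroupOf (H k)).Normal ∧ (B.subgroupOf (H k)).Normal ∧
      Nonempty (A ≃* FreeGroup ℕ) ∧ Nonempty (B ≃* FreeGroup ℕ) ∧
      A ⊓ B = ⊥ ∧
      (∀ a ∈ A, ∀ b ∈ B, a * b = b * a) := by
  obtain ⟨a, b, h⟩ := (FreeGroupBasis.ofFreeGroup (Fin 2)).exists_isFreePair
  have hab := h.mul_ne_mul
  have h₁ : (MonoidHom.inl F2 F2).range = (MonoidHom.snd F2 F2).ker :=
    Subgroup.ext fun z => ⟨fun ⟨_, h⟩ => h ▸ rfl, fun h => ⟨z.1, Prod.ext rfl h.symm⟩⟩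
  have h₂ : (MonoidHom.inr F2 F2).range = (MonoidHom.fst F2 F2).ker :=
    Subgroup.ext fun z => ⟨fun ⟨_, h⟩ => h ▸ rfl, fun h => ⟨z.2, Prod.ext h.symm rfl⟩⟩
  have : IsFreeGroup (MonoidHom.snd F2 F2).ker := h₁ ▸ IsFreeGroup.ofMulEquiv
    (MonoidHom.ofInjective (f := MonoidHom.inl F2 F2) fun _ _ h => congrArg Prod.fst h)
  have : IsFreeGroup (MonoidHom.fst F2 F2).ker := h₂ ▸ IsFreeGroup.ofMulEquiv
    (MonoidHom.ofInjective (f := MonoidHom.inr F2 F2) fun _ _ h => congrArg Prod.snd h)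
  obtain ⟨A, hAH, hA, hAn, hAe⟩ := Subgroup.exists_normal_freeGroup_nat_of_chain
    (MonoidHom.snd F2 F2).ker
    ⟨(a, 1), rfl, (b, 1), rfl, fun h => hab (congrArg Prod.fst h)⟩ k H h0 hnormal hquot
  obtain ⟨B, hBH, hB, hBn, hBe⟩ := Subgroup.exists_normal_freeGroup_nat_of_chain
    (MonoidHom.fst F2 F2).ker
    ⟨(1, a), rfl, (1, b), rfl, fun h => hab (congrArg Prod.snd h)⟩ k H h0 hnormal hquot
  refine ⟨A, B, hAH, hBH, hAn, hBn, hAe, hBe, ?_, fun x hx y hy => ?_⟩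
  · exact (Subgroup.eq_bot_iff_forall _).mpr fun x hx => Prod.ext (hB hx.2) (hA hx.1)
  · have hx2 : x.2 = 1 := hA hx
    have hy1 : y.1 = 1 := hB hy
    ext <;> simp [hx2, hy1]
end

section
/- Let G be a group acting on a set X, let a, b ∈ G, and let J⁺, A⁺, B⁺ ⊆ X be subsets satisfying a·J⁺ ⊆ A⁺, b·J⁺ ⊆ B⁺, A⁺ ⊆ J⁺, B⁺ ⊆ J⁺, and A⁺ ∩ B⁺ = ∅. For a word w over the alphabet {a,b} (a finite list of elements each equal to a or to b), let g(w) ∈ G denote the product of its letters in order. Then: (1) for every word u over {a,b}, g(u)·J⁺ ⊆ J⁺; (2) if a word u is a prefix of a word v, then g(v)·J⁺ ⊆ g(u)·J⁺; and (3) if neither of the words u, v is a prefix of the other, then g(u)·J⁺ ∩ g(v)·J⁺ = ∅. -/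
open Pointwise

/-- If every letter of a word maps `J` into itself, so does the product of the word. -/
theorem List.prod_smul_set_subset {M X : Type*} [Monoid M] [MulAction M X] {J : Set X}
    {u : List M} (hu : ∀ x ∈ u, x • J ⊆ J) : u.prod • J ⊆ J := by
  induction u with
  | nil => simp
  | cons x u ih =>
    rw [List.forall_mem_cons] at hu
    rw [List.prod_cons, mul_smul]
    exact (Set.smul_set_mono (ih hu.2)).trans hu.1

theorem List.IsPrefix.prod_smul_set_subset {M X : Type*} [Monoid M] [MulAction M X] {J : Set X}
    {u v : List M} (huv : u <+: v) (hv : ∀ x ∈ v, x • J ⊆ J) :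
    v.prod • J ⊆ u.prod • J := by
  obtain ⟨w, rfl⟩ := huv
  rw [List.prod_append, mul_smul]
  exact Set.smul_set_mono
    (List.prod_smul_set_subset fun x hx => hv x (List.mem_append_right u hx))

/-- If the letters in `S` map `J` to pairwise disjoint subsets of `J`, then prefix-incomparable
words over `S` map `J` to disjoint sets. -/
theorem List.disjoint_prod_smul_set {G X : Type*} [Group G] [MulAction G X] {J : Set X}
    {S : Set G} (hS : ∀ s ∈ S, s • J ⊆ J) (hdisj : S.PairwiseDisjoint (· • J))
    {u v : List G} (hu : ∀ x ∈ u, x ∈ S) (hv : ∀ x ∈ v, x ∈ S)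
    (huv : ¬ u <+: v) (hvu : ¬ v <+: u) : _root_.Disjoint (u.prod • J) (v.prod • J) := by
  induction u generalizing v with
  | nil => exact absurd List.nil_prefix huv
  | cons x u ih =>
    cases v with
    | nil => exact absurd List.nil_prefix hvu
    | cons y v =>
      rw [List.forall_mem_cons] at hu hv
      simp only [List.prod_cons, mul_smul]
      by_cases hxy : x = y
      · subst hxy
        rw [List.prefix_cons_inj] at huv hvu
        exact Set.disjoint_smul_set.2 (ih hu.2 hv.2 huv hvu)
      · exact (hdisj hu.1 hv.1 hxy).mono
          (Set.smul_set_mono (List.prod_smul_set_subset fun z hz => hS z (hu.2 z hz)))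
          (Set.smul_set_mono (List.prod_smul_set_subset fun z hz => hS z (hv.2 z hz)))

/-- Ping-pong-style estimates for halfspaces: given `a·J⁺ ⊆ A⁺ ⊆ J⁺`,
`b·J⁺ ⊆ B⁺ ⊆ J⁺` and `A⁺ ∩ B⁺ = ∅`, every positive word `u` in `{a,b}` satisfies
`g(u)·J⁺ ⊆ J⁺`; if `u` is a prefix of `v` then `g(v)·J⁺ ⊆ g(u)·J⁺`; and if neither of
`u`, `v` is a prefix of the other, then `g(u)·J⁺` and `g(v)·J⁺` are disjoint. -/
theorem halfspace_pingpong {G X : Type*} [Group G] [MulAction G X]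
    (a b : G) (Jp Ap Bp : Set X)
    (haJ : a • Jp ⊆ Ap) (hbJ : b • Jp ⊆ Bp)
    (hA : Ap ⊆ Jp) (hB : Bp ⊆ Jp) (hAB : Ap ∩ Bp = ∅) :
    (∀ u : List G, (∀ x ∈ u, x = a ∨ x = b) → u.prod • Jp ⊆ Jp) ∧
    (∀ u v : List G, (∀ x ∈ u, x = a ∨ x = b) → (∀ x ∈ v, x = a ∨ x = b) →
      u <+: v → v.prod • Jp ⊆ u.prod • Jp) ∧
    (∀ u v : List G, (∀ x ∈ u, x = a ∨ x = b) → (∀ x ∈ v, x = a ∨ x = b) →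
      ¬ u <+: v → ¬ v <+: u → (u.prod • Jp) ∩ (v.prod • Jp) = ∅) := by
  have hS : ∀ s, s = a ∨ s = b → s • Jp ⊆ Jp := by
    rintro s (rfl | rfl)
    exacts [haJ.trans hA, hbJ.trans hB]
  have hab : Disjoint (a • Jp) (b • Jp) := (Set.disjoint_iff_inter_eq_empty.2 hAB).mono haJ hbJ
  have hdisj : ({s | s = a ∨ s = b} : Set G).PairwiseDisjoint (· • Jp) := by
    rintro s (rfl | rfl) t (rfl | rfl) hst
    exacts [absurd rfl hst, hab, hab.symm, absurd rfl hst]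
  exact ⟨fun u hu => List.prod_smul_set_subset fun x hx => hS x (hu x hx),
    fun u v _ hv huv => huv.prod_smul_set_subset fun x hx => hS x (hv x hx),
    fun u v hu hv huv hvu => Set.disjoint_iff_inter_eq_empty.1
      (List.disjoint_prod_smul_set hS hdisj hu hv huv hvu)⟩
end
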